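/- Let A be a live weakly-hierarchical visibly pushdown automaton and ≈ a reachability-aware quotienting (RAQ) relation on the states of A. Then L(A) = L(A/≈), i.e., quotienting by a RAQ relation preserves the recognized language. -/

import Mathlib

/-- The kind of a symbol in a visibly pushdown alphabet:
internal, call, or return. -/
inductive SymKind : Type
  | int | call | ret
deriving DecidableEq

/-- A weakly-hierarchical visibly pushdown automaton over states `Q` and
alphabet `S`.  The partition of the alphabet is given by `kind`; the
bottom-of-stack symbol is implicit (stacks are lists of states, the empty
list playing the role of `⊥`, and the head of the list being the topmost
symbol). -/
structure VPA (Q : Type) (S : Type) where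
  kind : S → SymKind
  δi : Q → S → Q → Prop
  δc : Q → S → Q → Prop
  δr : Q → S → Q → Q → Prop
  Q0 : Set Q
  F : Set Q
  Q0_nonempty : Q0.Nonempty
  δi_kind : ∀ p a q, δi p a q → kind a = SymKind.int
  δc_kind : ∀ p c q, δc p c q → kind c = SymKind.call
  δr_kind : ∀ p r qh q, δr p r qh q → kind r = SymKind.ret

namespace VPA

variable {Q S : Type}

/-- A configuration: current state together with the stack
(head = topmost symbol; `[]` = the empty stack `⊥`). -/
abbrev Config (Q : Type) := Q × List Q

/-- One step of the automaton on a symbol. Internal symbols leave the stack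
unchanged, call symbols push the current state, return symbols pop the
matching topmost stack symbol. -/
def Step (A : VPA Q S) (c : Config Q) (s : S) (c' : Config Q) : Prop :=
  match A.kind s with
  | SymKind.int  => A.δi c.1 s c'.1 ∧ c'.2 = c.2
  | SymKind.call => A.δc c.1 s c'.1 ∧ c'.2 = c.1 :: c.2
  | SymKind.ret  => ∃ qh, A.δr c.1 s qh c'.1 ∧ c.2 = qh :: c'.2

/-- `ρ` is a run of `A` on the word `w`. -/
def IsRunOn (A : VPA Q S) (w : List S) (ρ : Fin (w.length + 1) → Config Q) : Prop :=
  ∀ i : Fin w.length, A.Step (ρ i.castSucc) (w.get i) (ρ i.succ)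

/-- A run is initial if it starts in an initial state with the empty stack `⊥`. -/
def IsInitial (A : VPA Q S) {n : ℕ} (ρ : Fin (n + 1) → Config Q) : Prop :=
  (ρ 0).1 ∈ A.Q0 ∧ (ρ 0).2 = []

/-- `A` accepts `w` if some initial run of `A` on `w` ends in an accepting state. -/
def Accepts (A : VPA Q S) (w : List S) : Prop :=
  ∃ ρ : Fin (w.length + 1) → Config Q,
    A.IsRunOn w ρ ∧ A.IsInitial ρ ∧ (ρ (Fin.last w.length)).1 ∈ A.F

/-- The language of `A`. -/
def lang (A : VPA Q S) : Set (List S) := {w | A.Accepts w}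

/-- A configuration is reachable if it occurs in some initial run of `A`. -/
def Reachable (A : VPA Q S) (c : Config Q) : Prop :=
  ∃ (w : List S) (ρ : Fin (w.length + 1) → Config Q),
    A.IsRunOn w ρ ∧ A.IsInitial ρ ∧ ∃ i, ρ i = c

/-- `tops A q` = set of topmost stack symbols of reachable stacks for `q`
(`none` plays the role of the bottom-of-stack symbol `⊥`). -/
def tops (A : VPA Q S) (q : Q) : Set (Option Q) :=
  {t | ∃ σ : List Q, A.Reachable (q, σ) ∧ σ.head? = t}

/-- `A` is live: every state has outgoing transitions for every internal and
call symbol, and has an outgoing return transition for return symbol `s` and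
stack symbol `qh` if and only if `qh` is the topmost symbol of some
reachable stack. -/
def Live (A : VPA Q S) : Prop :=
  (∀ q s, A.kind s = SymKind.int → ∃ q', A.δi q s q') ∧
  (∀ q s, A.kind s = SymKind.call → ∃ q', A.δc q s q') ∧
  (∀ q s qh, A.kind s = SymKind.ret →
    ((∃ q', A.δr q s qh q') ↔ some qh ∈ A.tops q))

/-- `R` is a reachability-aware quotienting (RAQ) relation for `A`. -/
def IsRAQ (A : VPA Q S) (R : Q → Q → Prop) : Prop :=
  Equivalence R ∧
  ∀ p q, R p q →
    (p ∈ A.F ↔ q ∈ A.F) ∧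
    (∀ a p', A.δi p a p' → ∃ q', A.δi q a q' ∧ R p' q') ∧
    (∀ a q', A.δi q a q' → ∃ p', A.δi p a p' ∧ R p' q') ∧
    (∀ c p', A.δc p c p' → ∃ q', A.δc q c q' ∧ R p' q') ∧
    (∀ c q', A.δc q c q' → ∃ p', A.δc p c p' ∧ R p' q') ∧
    (∀ ph qh, R ph qh →
      ((∀ r p', A.δr p r ph p' → ∃ q', A.δr q r qh q' ∧ R p' q') ∧
       (∀ r q', A.δr q r qh q' → ∃ p', A.δr p r ph p' ∧ R p' q'))
      ∨ some qh ∉ A.tops q ∨ some ph ∉ A.tops p)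

/-- The quotient VPA `A/R` for an equivalence relation (setoid) `R` on states. -/
def quot (A : VPA Q S) (R : Setoid Q) : VPA (Quotient R) S where
  kind := A.kind
  δi := fun P a P' => ∃ p p', A.δi p a p' ∧
    Quotient.mk R p = P ∧ Quotient.mk R p' = P'
  δc := fun P c P' => ∃ p p', A.δc p c p' ∧
    Quotient.mk R p = P ∧ Quotient.mk R p' = P'
  δr := fun P r Ph P' => ∃ p ph p', A.δr p r ph p' ∧
    Quotient.mk R p = P ∧ Quotient.mk R ph = Ph ∧ Quotient.mk R p' = P'
  Q0 := {P | ∃ q ∈ A.Q0, Quotient.mk R q = P}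
  F := {P | ∃ q ∈ A.F, Quotient.mk R q = P}
  Q0_nonempty := by
    obtain ⟨q, hq⟩ := A.Q0_nonempty
    exact ⟨Quotient.mk R q, q, hq, rfl⟩
  δi_kind := by rintro P a P' ⟨p, p', h, -, -⟩; exact A.δi_kind p a p' h
  δc_kind := by rintro P c P' ⟨p, p', h, -, -⟩; exact A.δc_kind p c p' h
  δr_kind := by rintro P r Ph P' ⟨p, ph, p', h, -, -, -⟩; exact A.δr_kind p r ph p' h

end VPA

/-- A word is matched-return if every prefix ending in a return symbol
has strictly more call symbols than return symbols before that return. -/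
def MR {S : Type} (kind : S → SymKind) (w : List S) : Prop :=
  ∀ v r, (v ++ [r]) <+: w → kind r = SymKind.ret →
    v.countP (fun s => decide (kind s = SymKind.call)) >
      v.countP (fun s => decide (kind s = SymKind.ret))

namespace VPA

variable {Q Q' S : Type}

/-- `A.Steps c w d`: reading the word `w` can lead `A` from `c` to `d`. -/
def Steps (A : VPA Q S) : Config Q → List S → Config Q → Prop
  | c, [], d => c = d
  | c, s :: w, d => ∃ e, A.Step c s e ∧ A.Steps e w d

theorem Steps.snoc {A : VPA Q S} {c d e : Config Q} {w : List S} {s : S}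
    (h : A.Steps c w d) (hs : A.Step d s e) : A.Steps c (w ++ [s]) e := by
  induction w generalizing c with
  | nil => cases h; exact ⟨e, hs, rfl⟩
  | cons a w ih =>
    obtain ⟨f, hf, h⟩ := h
    exact ⟨f, hf, ih h⟩

theorem steps_iff_exists_run {A : VPA Q S} {c d : Config Q} {w : List S} :
    A.Steps c w d ↔ ∃ ρ : Fin (w.length + 1) → Config Q,
      A.IsRunOn w ρ ∧ ρ 0 = c ∧ ρ (Fin.last w.length) = d := by
  induction w generalizing c with
  | nil =>
    constructor
    · intro h
      exact ⟨fun _ => c, fun i => i.elim0, rfl, h⟩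
    · rintro ⟨ρ, -, rfl, rfl⟩
      rfl
  | cons a w ih =>
    constructor
    · rintro ⟨e, hs, h⟩
      obtain ⟨ρ, hρ, rfl, rfl⟩ := ih.1 h
      refine ⟨Fin.cons c ρ, fun i => ?_, rfl, rfl⟩
      refine Fin.cases ?_ (fun j => ?_) i
      · exact hs
      · exact hρ j
    · rintro ⟨ρ, hρ, rfl, rfl⟩
      exact ⟨ρ 1, hρ 0, ih.2 ⟨fun i => ρ i.succ, fun i => hρ i.succ, rfl, rfl⟩⟩

theorem mem_lang_iff {A : VPA Q S} {w : List S} :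
    w ∈ A.lang ↔ ∃ c d, (c.1 ∈ A.Q0 ∧ c.2 = []) ∧ A.Steps c w d ∧ d.1 ∈ A.F := by
  constructor
  · rintro ⟨ρ, hρ, hi, hF⟩
    exact ⟨_, _, hi, steps_iff_exists_run.2 ⟨ρ, hρ, rfl, rfl⟩, hF⟩
  · rintro ⟨c, d, hi, h, hF⟩
    obtain ⟨ρ, hρ, rfl, rfl⟩ := steps_iff_exists_run.1 h
    exact ⟨ρ, hρ, hi, hF⟩

/-- `d` can be reached from an initial configuration. -/
def FromInitial (A : VPA Q S) (d : Config Q) : Prop :=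
  ∃ c w, (c.1 ∈ A.Q0 ∧ c.2 = []) ∧ A.Steps c w d

theorem FromInitial.reachable {A : VPA Q S} {d : Config Q} (h : A.FromInitial d) :
    A.Reachable d := by
  obtain ⟨c, w, hi, h⟩ := h
  obtain ⟨ρ, hρ, rfl, hd⟩ := steps_iff_exists_run.1 h
  exact ⟨w, ρ, hρ, hi, _, hd⟩

theorem FromInitial.step {A : VPA Q S} {d e : Config Q} {s : S}
    (h : A.FromInitial d) (hs : A.Step d s e) : A.FromInitial e := by
  obtain ⟨c, w, hi, h⟩ := h
  exact ⟨c, w ++ [s], hi, h.snoc hs⟩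

theorem Steps.simulate {A : VPA Q S} {B : VPA Q' S} {T : Config Q → Config Q' → Prop}
    (hT : ∀ c d s c', T c d → A.Step c s c' → ∃ d', B.Step d s d' ∧ T c' d')
    {c c' : Config Q} {d : Config Q'} {w : List S} (hcd : T c d) (h : A.Steps c w c') :
    ∃ d', B.Steps d w d' ∧ T c' d' := by
  induction w generalizing c d with
  | nil => cases h; exact ⟨d, rfl, hcd⟩
  | cons a w ih =>
    obtain ⟨e, hs, h⟩ := h
    obtain ⟨f, hf, hef⟩ := hT _ _ _ _ hcd hs
    obtain ⟨d', hd', hT'⟩ := ih hef h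
    exact ⟨d', ⟨f, hf, hd'⟩, hT'⟩

/-- The image of a configuration in the quotient automaton. -/
def quotConfig (R : Setoid Q) (c : Config Q) : Config (Quotient R) :=
  (Quotient.mk R c.1, c.2.map (Quotient.mk R))

theorem Step.quot {A : VPA Q S} (R : Setoid Q) {c d : Config Q} {s : S}
    (h : A.Step c s d) : (A.quot R).Step (quotConfig R c) s (quotConfig R d) := by
  obtain ⟨p, σ⟩ := c
  obtain ⟨q, τ⟩ := d
  unfold Step at h ⊢
  change match A.kind s with
    | SymKind.int => _
    | SymKind.call => _
    | SymKind.ret => _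
  cases hk : A.kind s <;> simp only [hk] at h ⊢
  · obtain ⟨h, rfl⟩ := h
    exact ⟨⟨p, q, h, rfl, rfl⟩, rfl⟩
  · obtain ⟨h, rfl⟩ := h
    exact ⟨⟨p, q, h, rfl, rfl⟩, rfl⟩
  · obtain ⟨u, h, rfl⟩ := h
    exact ⟨_, ⟨p, u, q, h, rfl, rfl, rfl⟩, rfl⟩

/-- Every step of the quotient automaton from the image of a reachable configuration
lifts to a step of the original automaton. -/
theorem IsRAQ.exists_step {A : VPA Q S} (hlive : A.Live) {R : Setoid Q}
    (hR : A.IsRAQ R.r) {c : Config Q} (hc : A.Reachable c) {s : S}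
    {D : Config (Quotient R)} (h : (A.quot R).Step (quotConfig R c) s D) :
    ∃ d, A.Step c s d ∧ quotConfig R d = D := by
  obtain ⟨p, σ⟩ := c
  obtain ⟨P, τ⟩ := D
  unfold Step at h ⊢
  change match A.kind s with
    | SymKind.int => _
    | SymKind.call => _
    | SymKind.ret => _ at h
  cases hk : A.kind s <;> simp only [hk] at h ⊢
  · obtain ⟨⟨q, q', hq, hqp, rfl⟩, rfl⟩ := h
    obtain ⟨p', hp, hp'⟩ := (hR.2 q p (Quotient.exact hqp)).2.1 s q' hq
    exact ⟨(p', σ), ⟨hp, rfl⟩, Prod.ext (Quotient.sound (R.symm hp')) rfl⟩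
  · obtain ⟨⟨q, q', hq, hqp, rfl⟩, rfl⟩ := h
    obtain ⟨p', hp, hp'⟩ := (hR.2 q p (Quotient.exact hqp)).2.2.2.1 s q' hq
    exact ⟨(p', p :: σ), ⟨hp, rfl⟩, Prod.ext (Quotient.sound (R.symm hp')) rfl⟩
  · obtain ⟨U, ⟨q, qh, q', hq, hqp, rfl, rfl⟩, hσ⟩ := h
    obtain ⟨ph, σ, rfl, hph, rfl⟩ := List.map_eq_cons_iff.1 hσ
    have hp_top : some ph ∈ A.tops p := ⟨_, hc, rfl⟩
    have hq_top : some qh ∈ A.tops q := (hlive.2.2 q s qh hk).1 ⟨q', hq⟩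
    rcases (hR.2 q p (Quotient.exact hqp)).2.2.2.2.2 qh ph
      (R.symm (Quotient.exact hph)) with hret | hret | hret
    · obtain ⟨p', hp, hp'⟩ := hret.1 s q' hq
      exact ⟨(p', σ), ⟨ph, hp, rfl⟩, Prod.ext (Quotient.sound (R.symm hp')) rfl⟩
    · exact absurd hp_top hret
    · exact absurd hq_top hret

end VPA

/-- **Language preservation of quotienting.**  Quotienting a live VPA by a
RAQ relation preserves the recognized language. -/
theorem lang_quot_eq {Q S : Type} [Fintype Q] [Fintype S]
    (A : VPA Q S) (hlive : A.Live) (R : Setoid Q) (hRAQ : A.IsRAQ R.r) :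
    A.lang = (A.quot R).lang := by
  ext w
  rw [VPA.mem_lang_iff, VPA.mem_lang_iff]
  constructor
  · rintro ⟨c, d, ⟨hc, hσ⟩, h, hF⟩
    obtain ⟨_, hD, rfl⟩ := h.simulate (B := A.quot R)
      (T := fun c D => VPA.quotConfig R c = D)
      (by rintro c _ s c' rfl hs; exact ⟨_, hs.quot R, rfl⟩) rfl
    exact ⟨_, _, ⟨⟨c.1, hc, rfl⟩, congrArg (List.map (Quotient.mk R)) hσ⟩, hD, ⟨d.1, hF, rfl⟩⟩
  · rintro ⟨⟨_, _⟩, _, ⟨⟨q, hq, rfl⟩, rfl⟩, h, hF⟩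
    obtain ⟨d, hd, -, rfl⟩ := h.simulate (B := A) (d := (q, []))
      (T := fun D d => A.FromInitial d ∧ VPA.quotConfig R d = D)
      (by
        rintro _ d s D' ⟨hd, rfl⟩ hs
        obtain ⟨e, he, rfl⟩ := hRAQ.exists_step hlive hd.reachable hs
        exact ⟨e, he, hd.step he, rfl⟩)
      ⟨⟨(q, []), [], ⟨hq, rfl⟩, rfl⟩, rfl⟩
    obtain ⟨f, hf, hfd⟩ := hF
    exact ⟨_, d, ⟨hq, rfl⟩, hd, (hRAQ.2 f d.1 (Quotient.exact hfd)).1.1 hf⟩
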